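/- arXiv:2212.11104 — 5 statements merged into one kernel-verified Lean document; each statement's English description precedes it below -/
import Mathlib

section
/- Let π : ℝᵈ → ℝⁿ be a surjective linear map, Q ⊆ ℝⁿ an additive subgroup containing X_j = π(e_j) for all j = 1,…,d, and I ⊆ {1,…,d} a set of n indices such that the restriction of π to V_I = span_ℝ{e_i : i ∈ I} is a linear isomorphism onto ℝⁿ. Let N_ℂ = {E(Z) : Z ∈ ℂᵈ, π_ℂ(Z) ∈ Q} ⊆ (ℂ*)ᵈ act on ℂᵈ by componentwise multiplication, and define ι : ℂ^I → ℂᵈ by (ι z)_i = z_i for i ∈ I and (ι z)_j = 1 for j ∉ I. Then for any z, z' ∈ ℂ^I, the points ι(z) and ι(z') lie in the same N_ℂ-orbit if and only if there exists γ ∈ Γ_σ with z'_i = γ_i z_i for all i ∈ I, where Γ_σ = {(e^{2πi y_i})_{i∈I} : Y ∈ V_I, π(Y) ∈ Q} and y_i denotes the i-th coordinate of Y. In particular the chart map η_σ : ℂ^I/Γ_σ → ιℂ^I·N_ℂ/N_ℂ induced by ι is well defined and injective. -/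
/-- The componentwise exponential factor `e^{2πi z}`. -/
noncomputable def e2 (z : ℂ) : ℂ := Complex.exp (2 * (Real.pi : ℂ) * Complex.I * z)

theorem e2_eq_one_iff (z : ℂ) : e2 z = 1 ↔ ∃ m : ℤ, z = m := by
  have h : (2 * (Real.pi : ℂ) * Complex.I) ≠ 0 := Complex.two_pi_I_ne_zero
  rw [e2, Complex.exp_eq_one_iff]
  refine exists_congr fun m => ?_
  rw [mul_comm (m : ℂ)]
  exact mul_right_inj' h

theorem mem_span_single_image_iff {ι R : Type*} [Fintype ι] [DecidableEq ι] [Semiring R]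
    (s : Finset ι) (v : ι → R) :
    v ∈ Submodule.span R ((fun i : ι => Pi.single i (1 : R)) '' s) ↔ ∀ j ∉ s, v j = 0 := by
  constructor
  · intro hv j hj
    induction hv using Submodule.span_induction with
    | mem x hx =>
      obtain ⟨i, hi, rfl⟩ := hx
      have hne : j ≠ i := by rintro rfl; exact hj hi
      exact Pi.single_eq_of_ne hne _
    | zero => rfl
    | add x y _ _ hx hy => simp [hx, hy]
    | smul a x _ hx => simp [hx]
  · intro hv
    rw [pi_eq_sum_univ' v]
    refine Submodule.sum_mem _ fun i _ => ?_
    by_cases hi : i ∈ s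
    · refine Submodule.smul_mem _ _ (Submodule.subset_span ⟨i, hi, ?_⟩)
      ext j
      simp [Pi.single_apply, eq_comm]
    · simp [hv i hi]

theorem LinearMap.apply_eq_sum_single {ι κ R : Type*} [Fintype ι] [DecidableEq ι] [CommSemiring R]
    (f : (ι → R) →ₗ[R] (κ → R)) (v : ι → R) (i : κ) :
    f v i = ∑ j, v j * f (Pi.single j 1) i := by
  rw [f.pi_apply_eq_sum_univ v]
  simp only [Finset.sum_apply, Pi.smul_apply, smul_eq_mul]
  refine Finset.sum_congr rfl fun j _ => ?_
  have h : (fun k => if j = k then 1 else 0 : ι → R) = Pi.single j 1 := by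
    ext k
    simp [Pi.single_apply, eq_comm]
  simp [h]

/-- With `π`, `Q` (containing all `π(e_j)`), `I`, `V_I` as usual and
`N_ℂ = E(π_ℂ⁻¹(Q)) ⊆ (ℂ*)ᵈ` acting on `ℂᵈ` componentwise, two points
`ι(z), ι(z')` of the slice (`z` on `I`, `1` off `I`) lie in the same
`N_ℂ`-orbit iff `z' = γ·z` on `I` for some `γ ∈ Γ_σ`, i.e. `γ = E(Y)` with
`Y ∈ V_I`, `π(Y) ∈ Q`. Hence the chart map `η_σ : ℂ^I/Γ_σ → U_σ/N_ℂ` is well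
defined and injective. -/
theorem stmt8 (d n : ℕ) (π : (Fin d → ℝ) →ₗ[ℝ] (Fin n → ℝ))
    (hsurj : Function.Surjective π)
    (Q : AddSubgroup (Fin n → ℝ))
    (hX : ∀ j, π (Pi.single j 1) ∈ Q)
    (I : Finset (Fin d)) (hcard : I.card = n)
    (VI : Submodule ℝ (Fin d → ℝ))
    (hVI : VI = Submodule.span ℝ ((fun i : Fin d => Pi.single i (1 : ℝ)) '' I))
    (hbij : Function.Bijective (π.comp VI.subtype))
    (πC : (Fin d → ℂ) →ₗ[ℂ] (Fin n → ℂ))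
    (hπC : ∀ Z i, πC Z i = ∑ j, Z j * ((π (Pi.single j 1)) i : ℂ))
    (QC : Set (Fin n → ℂ))
    (hQC : QC = {v : Fin n → ℂ | ∃ q ∈ Q, ∀ i, v i = (q i : ℂ)})
    (NC : Set (Fin d → ℂ))
    (hNC : NC = {g : Fin d → ℂ | ∃ Z : Fin d → ℂ, πC Z ∈ QC ∧ ∀ j, g j = e2 (Z j)})
    (z z' : Fin d → ℂ)
    (ιz ιz' : Fin d → ℂ)
    (hι : ιz = fun j => if j ∈ I then z j else 1)
    (hι' : ιz' = fun j => if j ∈ I then z' j else 1) :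
    (∃ g ∈ NC, ∀ j, ιz' j = g j * ιz j) ↔
      (∃ Y : Fin d → ℝ, Y ∈ VI ∧ π Y ∈ Q ∧ ∀ i ∈ I, z' i = e2 (Y i : ℂ) * z i) := by
  subst hι hι' hNC hQC
  have hmem (Y : Fin d → ℝ) : Y ∈ VI ↔ ∀ j ∉ I, Y j = 0 := by
    rw [hVI]; exact mem_span_single_image_iff I Y
  constructor
  · rintro ⟨g, ⟨Z, ⟨q, hq, hZq⟩, hg⟩, hgz⟩
    have hint (j : Fin d) : ∃ m : ℤ, j ∉ I → Z j = m := by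
      by_cases hj : j ∈ I
      · exact ⟨0, fun h => absurd hj h⟩
      · have h := hgz j
        simp only [hj, if_false, mul_one, hg] at h
        obtain ⟨m, hm⟩ := (e2_eq_one_iff _).1 h.symm
        exact ⟨m, fun _ => hm⟩
    choose m hm using hint
    have hre : π (fun j => (Z j).re) = q := by
      ext i
      have h := congrArg Complex.re (hZq i)
      rw [hπC] at h
      rw [π.apply_eq_sum_single]
      simpa using h
    have him : π (fun j => (Z j).im) = 0 := by
      ext i
      have h := congrArg Complex.im (hZq i)
      rw [hπC] at h
      rw [π.apply_eq_sum_single]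
      simpa using h
    have him_mem : (fun j => (Z j).im) ∈ VI := (hmem _).2 fun j hj => by simp [hm j hj]
    have him_zero : (fun j => (Z j).im) = 0 := by
      have h : (⟨_, him_mem⟩ : VI) = 0 := hbij.injective (by simpa using him)
      exact congrArg Subtype.val h
    refine ⟨fun j => if j ∈ I then (Z j).re else 0, (hmem _).2 fun j hj => by simp [hj], ?_, ?_⟩
    · have hsplit : (fun j => if j ∈ I then (Z j).re else 0) =
          (fun j => (Z j).re) - ∑ j ∈ Iᶜ, m j • (Pi.single j (1 : ℝ) : Fin d → ℝ) := by
        ext k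
        by_cases hk : k ∈ I <;>
          simp [hk, Finset.sum_apply, Pi.single_apply, hm k]
      rw [hsplit, map_sub, hre, map_sum]
      refine Q.sub_mem hq (Q.sum_mem fun j _ => ?_)
      rw [map_zsmul]
      exact Q.zsmul_mem (hX j) _
    · intro i hi
      have hZi : (((Z i).re : ℝ) : ℂ) = Z i :=
        Complex.ext (by simp) (by simpa using (congrFun him_zero i).symm)
      have h := hgz i
      simp only [hi, if_true, hg] at h
      simpa only [hi, if_true, hZi] using h
  · rintro ⟨Y, hY, hYQ, hYz⟩
    refine ⟨fun j => e2 (Y j), ⟨fun j => Y j, ⟨π Y, hYQ, fun i => ?_⟩, fun _ => rfl⟩, fun j => ?_⟩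
    · rw [hπC, π.apply_eq_sum_single Y]
      push_cast
      rfl
    · by_cases hj : j ∈ I
      · simp [hj, hYz j hj]
      · simp [hj, (hmem Y).1 hY j hj, e2]
end

section
/- Let π : ℝᵈ → ℝⁿ be a surjective linear map, Q ⊆ ℝⁿ an additive subgroup, and I ⊆ {1,…,d} a set of n indices such that the restriction of π to V_I = span_ℝ{e_i : i ∈ I} is a linear isomorphism onto ℝⁿ. Let N_ℂ = {E(Z) : Z ∈ ℂᵈ, π_ℂ(Z) ∈ Q} ⊆ (ℂ*)ᵈ. Then for every point z ∈ ℂᵈ with z_j ≠ 0 for all j ∉ I, there exists g ∈ N_ℂ (in fact g = E(W) with W ∈ ker(π_ℂ)) such that (g·z)_j = 1 for all j ∉ I; here g acts on z by componentwise multiplication. In particular every N_ℂ-orbit in U_σ = {z ∈ ℂᵈ : z_j ≠ 0 for j ∉ I} meets the slice {z ∈ ℂᵈ : z_j = 1 for j ∉ I}, so the chart map η_σ is surjective onto U_σ/N_ℂ. -/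
theorem exists_e2_mul_eq_one {z : ℂ} (hz : z ≠ 0) : ∃ w : ℂ, e2 w * z = 1 := by
  refine ⟨-Complex.log z / (2 * (Real.pi : ℂ) * Complex.I), ?_⟩
  rw [e2, mul_div_cancel₀ _ Complex.two_pi_I_ne_zero, Complex.exp_neg, Complex.exp_log hz,
    inv_mul_cancel₀ hz]

theorem apply_eq_zero_of_mem_span_single {d : ℕ} {I : Finset (Fin d)} {x : Fin d → ℝ}
    (hx : x ∈ Submodule.span ℝ ((fun i : Fin d => Pi.single i (1 : ℝ)) '' I))
    {j : Fin d} (hj : j ∉ I) : x j = 0 := by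
  have hle : Submodule.span ℝ ((fun i : Fin d => (Pi.single i (1 : ℝ) : Fin d → ℝ)) '' I) ≤
      LinearMap.ker (LinearMap.proj j : (Fin d → ℝ) →ₗ[ℝ] ℝ) := by
    rw [Submodule.span_le]
    rintro _ ⟨i, hi, rfl⟩
    have hji : j ≠ i := fun h => hj (h ▸ hi)
    simp [hji]
  exact hle hx

theorem map_apply_eq_sum_single {d n : ℕ} (π : (Fin d → ℝ) →ₗ[ℝ] (Fin n → ℝ))
    (x : Fin d → ℝ) (i : Fin n) : π x i = ∑ j, x j * π (Pi.single j 1) i := by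
  conv_lhs => rw [← Finset.univ_sum_single x, map_sum, Finset.sum_apply]
  refine Finset.sum_congr rfl fun j _ => ?_
  have h : (Pi.single j (x j) : Fin d → ℝ) = x j • Pi.single j 1 := by
    rw [← Pi.single_smul, smul_eq_mul, mul_one]
  rw [h, map_smul, Pi.smul_apply, smul_eq_mul]

/-- With `π`, `I`, `V_I` as usual, every `z ∈ ℂᵈ` with `z_j ≠ 0`
for all `j ∉ I` can be moved by an element `g = E(W)`, `W ∈ ker π_ℂ` (so in
particular `g ∈ N_ℂ`), to a point whose coordinates off `I` are all `1`:
every `N_ℂ`-orbit in `U_σ` meets the slice `{z_j = 1 for j ∉ I}`, so the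
chart map `η_σ` is surjective onto `U_σ/N_ℂ`. -/
theorem stmt9 (d n : ℕ) (π : (Fin d → ℝ) →ₗ[ℝ] (Fin n → ℝ))
    (hsurj : Function.Surjective π)
    (Q : AddSubgroup (Fin n → ℝ))
    (I : Finset (Fin d)) (hcard : I.card = n)
    (VI : Submodule ℝ (Fin d → ℝ))
    (hVI : VI = Submodule.span ℝ ((fun i : Fin d => Pi.single i (1 : ℝ)) '' I))
    (hbij : Function.Bijective (π.comp VI.subtype))
    (πC : (Fin d → ℂ) →ₗ[ℂ] (Fin n → ℂ))
    (hπC : ∀ Z i, πC Z i = ∑ j, Z j * ((π (Pi.single j 1)) i : ℂ))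
    (z : Fin d → ℂ) (hz : ∀ j ∉ I, z j ≠ 0) :
    ∃ W : Fin d → ℂ, πC W = 0 ∧ ∀ j ∉ I, e2 (W j) * z j = 1 := by
  classical
  choose! w hw using fun (j : Fin d) (hj : j ∉ I) => exists_e2_mul_eq_one (hz j hj)
  obtain ⟨x, hx⟩ := hbij.2 fun i => (πC w i).re
  obtain ⟨y, hy⟩ := hbij.2 fun i => (πC w i).im
  have hx_zero : ∀ j ∉ I, (x : Fin d → ℝ) j = 0 := fun j hj =>
    apply_eq_zero_of_mem_span_single (hVI ▸ x.2) hj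
  have hy_zero : ∀ j ∉ I, (y : Fin d → ℝ) j = 0 := fun j hj =>
    apply_eq_zero_of_mem_span_single (hVI ▸ y.2) hj
  have hreal : ∀ u : Fin d → ℝ, πC (fun j => (u j : ℂ)) = fun i => ((π u i : ℝ) : ℂ) := by
    intro u
    ext i
    rw [hπC, map_apply_eq_sum_single]
    push_cast
    rfl
  refine ⟨w - ((fun j => ((x : Fin d → ℝ) j : ℂ)) +
    Complex.I • fun j => ((y : Fin d → ℝ) j : ℂ)), ?_, fun j hj => ?_⟩
  · have hx' : π x = fun i => (πC w i).re := hx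
    have hy' : π y = fun i => (πC w i).im := hy
    rw [map_sub, map_add, map_smul, hreal, hreal, hx', hy']
    ext i
    simp [mul_comm Complex.I, Complex.re_add_im]
  · simpa [hx_zero j hj, hy_zero j hj] using hw j hj
end

section
/- Let π : ℝᵈ → ℝⁿ be a surjective linear map with X_j = π(e_j), and suppose that for the index sets I_σ = {1,…,n} and I_τ = {h+1,…,n+h} (1 ≤ h ≤ n−1, n+h ≤ d) the restrictions of π to V_{I_σ} and V_{I_τ} are linear isomorphisms onto ℝⁿ. For j = n+1,…,n+h write aʲ = (a_{1j},…,a_{nj}) for the coordinates of π_σ⁻¹(X_j) ∈ V_{I_σ}, where π_σ is the restriction of π to V_{I_σ}. Let z_{h+1},…,z_n ∈ ℂ and z_{n+1},…,z_{n+h} ∈ ℂ*, and choose w_j ∈ ℂ with e^{2πi w_j} = z_j for j = n+1,…,n+h. Then the two points of ℂᵈ given by P = (1,…,1, z_{h+1},…,z_{n+h}, 1,…,1) (entries 1 in positions 1,…,h and n+h+1,…,d) and P' with P'_i = ∏_{j=n+1}^{n+h} e^{2πi a_{ij} w_j} for i = 1,…,h, P'_i = (∏_{j=n+1}^{n+h}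 e^{2πi a_{ij} w_j})·z_i for i = h+1,…,n, and P'_j = 1 for j = n+1,…,d, satisfy P' = g·P for some g = E(W) with W ∈ ker(π_ℂ). Hence the transition between the affine charts of the toric quasifold associated to σ and τ is given by the generalized Laurent monomials [z_{h+1} : ⋯ : z_{n+h}] ↦ [z̲^{a̲₁} : ⋯ : z̲^{a̲_h} : z̲^{a̲_{h+1}} z_{h+1} : ⋯ : z̲^{a̲_n} z_n]. -/
theorem e2_zero : e2 0 = 1 := by simp [e2]

theorem e2_sum {ι : Type*} (s : Finset ι) (f : ι → ℂ) :
    e2 (∑ j ∈ s, f j) = ∏ j ∈ s, e2 (f j) := by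
  simp only [e2, Finset.mul_sum, Complex.exp_sum]

theorem e2_neg_mul_self (z : ℂ) : e2 (-z) * e2 z = 1 := by
  simp only [e2]
  rw [← Complex.exp_add, mul_neg, neg_add_cancel, Complex.exp_zero]

/-- A vector in the span of the first `n` basis vectors vanishes in the other coordinates. -/
theorem apply_eq_zero_of_mem_span_single_s10 {d n : ℕ} {v : Fin d → ℝ}
    (hv : v ∈ Submodule.span ℝ {v : Fin d → ℝ | ∃ i : Fin d, i.val < n ∧ v = Pi.single i 1})
    {i : Fin d} (hi : n ≤ i.val) : v i = 0 := by
  have hle : Submodule.span ℝ {v : Fin d → ℝ | ∃ i : Fin d, i.val < n ∧ v = Pi.single i 1} ≤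
      LinearMap.ker (LinearMap.proj i : (Fin d → ℝ) →ₗ[ℝ] ℝ) := by
    rw [Submodule.span_le]
    rintro _ ⟨k, hk, rfl⟩
    have hne : i ≠ k := by
      rintro rfl
      omega
    simp [hne]
  exact hle hv

/-- The matrix form of a real relation `π v = 0`, with complex coefficients. -/
theorem sum_mul_apply_single_eq_zero {d n : ℕ} (π : (Fin d → ℝ) →ₗ[ℝ] (Fin n → ℝ))
    {v : Fin d → ℝ} (hv : π v = 0) (k : Fin n) :
    ∑ i, (v i : ℂ) * ((π (Pi.single i 1)) k : ℂ) = 0 := by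
  have h1 := congrFun (LinearMap.pi_apply_eq_sum_univ π v) k
  simp only [hv, Finset.sum_apply, Pi.smul_apply, smul_eq_mul, Pi.zero_apply] at h1
  have hs : ∀ i : Fin d, (fun j => if i = j then (1 : ℝ) else 0) = Pi.single i 1 := by
    intro i
    ext j
    simp [Pi.single_apply, eq_comm]
  simp only [hs] at h1
  exact_mod_cast h1.symm

/-- chart transitions are given by generalized Laurent monomials.
With `I_σ = {1,…,n}`, `I_τ = {h+1,…,n+h}` (here `0`-indexed: `I_σ = {j < n}`,
`I_τ = {h ≤ j < n+h}`), `aʲ = π_σ⁻¹(π(e_j))` for `n ≤ j < n+h`, and chosen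
logarithms `w_j` of the `z_j`, the point
`P = (1,…,1,z_{h+1},…,z_{n+h},1,…,1)` and the point `P'` whose first `n`
coordinates are the generalized Laurent monomials
`z̲^{a̲_i}` (times `z_i` for `h < i ≤ n`) and whose remaining coordinates are
`1`, lie in the same `exp(𝔫_ℂ)`-orbit: `P' = E(W)·P` with `W ∈ ker π_ℂ`. -/
theorem stmt10 (d n h : ℕ) (hh1 : 1 ≤ h) (hhn : h ≤ n - 1) (hnd : n + h ≤ d)
    (π : (Fin d → ℝ) →ₗ[ℝ] (Fin n → ℝ)) (hsurj : Function.Surjective π)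
    (πC : (Fin d → ℂ) →ₗ[ℂ] (Fin n → ℂ))
    (hπC : ∀ Z i, πC Z i = ∑ j, Z j * ((π (Pi.single j 1)) i : ℂ))
    (Vσ Vτ : Submodule ℝ (Fin d → ℝ))
    (hVσ : Vσ = Submodule.span ℝ
      {v : Fin d → ℝ | ∃ i : Fin d, i.val < n ∧ v = Pi.single i 1})
    (hVτ : Vτ = Submodule.span ℝ
      {v : Fin d → ℝ | ∃ i : Fin d, h ≤ i.val ∧ i.val < n + h ∧ v = Pi.single i 1})
    (hbσ : Function.Bijective (π.comp Vσ.subtype))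
    (hbτ : Function.Bijective (π.comp Vτ.subtype))
    (a : Fin d → (Fin d → ℝ))
    (ha : ∀ j : Fin d, n ≤ j.val → j.val < n + h →
      a j ∈ Vσ ∧ π (a j) = π (Pi.single j 1))
    (z w : Fin d → ℂ)
    (hw : ∀ j : Fin d, n ≤ j.val → j.val < n + h → e2 (w j) = z j)
    (P P' : Fin d → ℂ)
    (hP : P = fun j => if h ≤ j.val ∧ j.val < n + h then z j else 1)
    (hP' : P' = fun i =>
      if i.val < h then
        ∏ j : Fin d,
          (if n ≤ j.val ∧ j.val < n + h then e2 ((a j i : ℂ) * w j) else 1)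
      else if i.val < n then
        (∏ j : Fin d,
          (if n ≤ j.val ∧ j.val < n + h then e2 ((a j i : ℂ) * w j) else 1)) * z i
      else 1) :
    ∃ W : Fin d → ℂ, πC W = 0 ∧ ∀ i, P' i = e2 (W i) * P i := by
  subst hP hP' hVσ
  refine ⟨fun i => ∑ j : Fin d, if n ≤ j.val ∧ j.val < n + h then
    (((a j - Pi.single j 1 : Fin d → ℝ) i : ℝ) : ℂ) * w j else 0, ?_, fun i => ?_⟩
  · ext k
    rw [hπC]
    simp only [Finset.sum_mul, Pi.zero_apply]
    rw [Finset.sum_comm]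
    refine Finset.sum_eq_zero fun j _ => ?_
    split_ifs with hj
    · have hker : π (a j - Pi.single j 1) = 0 := by
        rw [map_sub, (ha j hj.1 hj.2).2, sub_self]
      simp only [mul_right_comm _ (w j)]
      rw [← Finset.sum_mul, sum_mul_apply_single_eq_zero π hker, zero_mul]
    · simp
  · by_cases hin : i.val < n
    · have hprod : e2 (∑ j : Fin d, if n ≤ j.val ∧ j.val < n + h then
          (((a j - Pi.single j 1 : Fin d → ℝ) i : ℝ) : ℂ) * w j else 0) =
          ∏ j : Fin d, (if n ≤ j.val ∧ j.val < n + h then e2 ((a j i : ℂ) * w j) else 1) := by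
        rw [e2_sum]
        refine Finset.prod_congr rfl fun j _ => ?_
        split_ifs with hj
        · have hne : i ≠ j := by
            rintro rfl
            omega
          simp [hne]
        · exact e2_zero
      simp only [hprod]
      by_cases hih : i.val < h
      · have hP : ¬(h ≤ i.val ∧ i.val < n + h) := by omega
        rw [if_pos hih, if_neg hP, mul_one]
      · have hP : h ≤ i.val ∧ i.val < n + h := by omega
        rw [if_neg hih, if_pos hin, if_pos hP]
    · have hsum : (∑ j : Fin d, if n ≤ j.val ∧ j.val < n + h then
          (((a j - Pi.single j 1 : Fin d → ℝ) i : ℝ) : ℂ) * w j else 0) =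
          if n ≤ i.val ∧ i.val < n + h then -w i else 0 := by
        rw [Finset.sum_eq_single i]
        · split_ifs with hi
          · simp [apply_eq_zero_of_mem_span_single_s10 (ha i hi.1 hi.2).1 hi.1]
          · rfl
        · intro j _ hji
          split_ifs with hj
          · simp [apply_eq_zero_of_mem_span_single_s10 (ha j hj.1 hj.2).1 (not_lt.mp hin),
              hji.symm]
          · rfl
        · simp
      have hih : ¬ i.val < h := by omega
      simp only [hsum]
      rw [if_neg hih, if_neg hin]
      by_cases hi : i.val < n + h
      · have h1 : n ≤ i.val ∧ i.val < n + h := by omega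
        have h2 : h ≤ i.val ∧ i.val < n + h := by omega
        rw [if_pos h1, if_pos h2, ← hw i h1.1 h1.2, e2_neg_mul_self]
      · have h1 : ¬(n ≤ i.val ∧ i.val < n + h) := by omega
        have h2 : ¬(h ≤ i.val ∧ i.val < n + h) := by omega
        rw [if_neg h1, if_neg h2, e2_zero, mul_one]
end

section
/- Let a be a real number and let Q = ℤ × (ℤ + aℤ) ⊆ ℝ². Consider the linear map π_ℂ : ℂ³ → ℂ² with π_ℂ(e₁) = (1,0), π_ℂ(e₂) = (−1,−a), π_ℂ(e₃) = (0,1). Then, as subsets of (ℂ*)³, {(e^{2πi z₁}, e^{2πi z₂}, e^{2πi z₃}) : z ∈ ℂ³, π_ℂ(z) ∈ Q} = {(e^{2πi u}, e^{2πi u}, e^{2πi a u}) : u ∈ ℂ}. That is, for the fundamental triple of the generalized weighted projective space ℂP²_{(1,1,a)} (normal fan of the right triangle T_a with vertices (0,0), (a,0), (0,1); quasilattice ℤ × (ℤ + aℤ); normals X₁ = (1,0), X₂ = −(1,a), X₃ = (0,1)), the group N_ℂ = ker Π_ℂ equals {(e^{2πi u}, e^{2πi u}, e^{2πi a u}) :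 u ∈ ℂ}. -/
theorem e2_add_intCast (z : ℂ) (n : ℤ) : e2 (z + n) = e2 z :=
  Complex.exp_eq_exp_iff_exists_int.2 ⟨n, by ring⟩

/-- For the generalized weighted projective space
`ℂP²_{(1,1,a)}` (fundamental triple: normal fan of the right triangle `T_a`,
quasilattice `Q = ℤ × (ℤ + aℤ)`, normals `X₁ = (1,0)`, `X₂ = -(1,a)`,
`X₃ = (0,1)`, so `π_ℂ(z) = (z₁ - z₂, -a z₂ + z₃)`), the group
`N_ℂ = {(e^{2πi z₁}, e^{2πi z₂}, e^{2πi z₃}) : π_ℂ(z) ∈ Q}` equals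
`{(e^{2πi u}, e^{2πi u}, e^{2πi a u}) : u ∈ ℂ}`. -/
theorem stmt15 (a : ℝ) :
    {p : ℂ × ℂ × ℂ | ∃ z₁ z₂ z₃ : ℂ,
        (∃ m k l : ℤ, z₁ - z₂ = (m : ℂ) ∧
          -(a : ℂ) * z₂ + z₃ = (k : ℂ) + (l : ℂ) * (a : ℂ)) ∧
        p.1 = e2 z₁ ∧ p.2.1 = e2 z₂ ∧ p.2.2 = e2 z₃} =
      {p : ℂ × ℂ × ℂ | ∃ u : ℂ,
        p.1 = e2 u ∧ p.2.1 = e2 u ∧ p.2.2 = e2 ((a : ℂ) * u)} := by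
  ext ⟨p₁, p₂, p₃⟩
  constructor
  · rintro ⟨z₁, z₂, z₃, ⟨m, k, l, h₁₂, h₂₃⟩, hp₁, hp₂, hp₃⟩
    obtain rfl : z₁ = z₂ + m := by linear_combination h₁₂
    obtain rfl : z₃ = a * (z₂ + l) + k := by linear_combination h₂₃
    rw [e2_add_intCast] at hp₁ hp₃
    exact ⟨z₂ + l, by rwa [e2_add_intCast], by rwa [e2_add_intCast], hp₃⟩
  · rintro ⟨u, hp₁, hp₂, hp₃⟩
    exact ⟨u, u, a * u, ⟨0, 0, 0, by simp, by simp⟩, hp₁, hp₂, hp₃⟩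
end

section
/- Let φ = (1+√5)/2 be the golden ratio, let Y_k = (cos(2πk/5), sin(2πk/5)) ∈ ℝ² for k = 0,…,4 be the fifth roots of unity, and let Q₅ ⊆ ℝ² be the additive subgroup generated by Y₀,…,Y₄ (the pentagonal quasilattice). Consider the linear map π_ℂ : ℂ⁴ → ℂ² with π_ℂ(e₁) = −Y₁, π_ℂ(e₂) = −Y₃, π_ℂ(e₃) = Y₂, π_ℂ(e₄) = Y₄. Then, as subsets of (ℂ*)⁴, {(e^{2πi z₁}, e^{2πi z₂}, e^{2πi z₃}, e^{2πi z₄}) : z ∈ ℂ⁴, π_ℂ(z) ∈ Q₅} = {(e^{2πi (φu − v)}, e^{2πi u}, e^{2πi v}, e^{2πi (φv − u)}) : u, v ∈ ℂ}. That is, for the fundamental triple of the toric quasifold of the Penrose kite, the group N_ℂ = ker Π_ℂ equals {(e^{2πi (φu − v)}, e^{2πi u}, e^{2πi v}, e^{2πi (φv − u)}) : u, v ∈ ℂ}. -/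
theorem cos_two_pi_div_five {φ : ℝ} (hφ : φ = (1 + Real.sqrt 5) / 2) :
    Real.cos (2 * Real.pi / 5) = (φ - 1) / 2 := by
  have h5 : Real.sqrt 5 ^ 2 = 5 := Real.sq_sqrt (by norm_num)
  rw [show 2 * Real.pi / 5 = 2 * (Real.pi / 5) by ring, Real.cos_two_mul,
    Real.cos_pi_div_five, hφ]
  linear_combination h5 / 8

theorem goldenRatio_sq_eq {φ : ℝ} (hφ : φ = (1 + Real.sqrt 5) / 2) : φ ^ 2 = φ + 1 := by
  have h5 : Real.sqrt 5 ^ 2 = 5 := Real.sq_sqrt (by norm_num)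
  rw [hφ]
  linear_combination h5 / 4

theorem fifth_roots_coordinates {φ : ℝ} (hφ : φ = (1 + Real.sqrt 5) / 2)
    {Y : Fin 5 → ℝ × ℝ}
    (hY : ∀ k : Fin 5,
      Y k = (Real.cos (2 * Real.pi * (k : ℕ) / 5),
             Real.sin (2 * Real.pi * (k : ℕ) / 5))) :
    ∃ S : ℝ, S ≠ 0 ∧ Y 0 = (1, 0) ∧ Y 1 = ((φ - 1) / 2, S) ∧
      Y 2 = (-φ / 2, (φ - 1) * S) ∧ Y 3 = (-φ / 2, -((φ - 1) * S)) ∧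
      Y 4 = ((φ - 1) / 2, -S) := by
  have hC := cos_two_pi_div_five hφ
  have hsq := goldenRatio_sq_eq hφ
  have hcos : Real.cos (2 * (2 * Real.pi / 5)) = -φ / 2 := by
    rw [Real.cos_two_mul, hC]
    linear_combination hsq / 2
  have hsin : Real.sin (2 * (2 * Real.pi / 5)) = (φ - 1) * Real.sin (2 * Real.pi / 5) := by
    rw [Real.sin_two_mul, hC]
    ring
  refine ⟨Real.sin (2 * Real.pi / 5), ?_, ?_, ?_, ?_, ?_, ?_⟩
  · exact (Real.sin_pos_of_pos_of_lt_pi (by positivity) (by linarith [Real.pi_pos])).ne'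
  · simp [hY]
  · simp [hY, hC]
  · rw [hY, show 2 * Real.pi * ((2 : Fin 5) : ℕ) / 5 = 2 * (2 * Real.pi / 5) by
      simp; ring, hcos, hsin]
  · rw [hY, show 2 * Real.pi * ((3 : Fin 5) : ℕ) / 5
      = 2 * Real.pi - 2 * (2 * Real.pi / 5) by simp; ring,
      Real.cos_two_pi_sub, Real.sin_two_pi_sub, hcos, hsin]
  · rw [hY, show 2 * Real.pi * ((4 : Fin 5) : ℕ) / 5 = 2 * Real.pi - 2 * Real.pi / 5 by
      simp; ring, Real.cos_two_pi_sub, Real.sin_two_pi_sub, hC]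

/-- For the Penrose kite (fundamental triple: normal fan of the
kite, pentagonal quasilattice `Q₅` generated by the fifth roots of unity
`Y₀,…,Y₄`, normals `X₁ = -Y₁`, `X₂ = -Y₃`, `X₃ = Y₂`, `X₄ = Y₄`, so
`π_ℂ(z) = -z₁Y₁ - z₂Y₃ + z₃Y₂ + z₄Y₄`), the group
`N_ℂ = {(e^{2πi z₁}, …, e^{2πi z₄}) : π_ℂ(z) ∈ Q₅}` equals
`{(e^{2πi (φu - v)}, e^{2πi u}, e^{2πi v}, e^{2πi (φv - u)}) : u, v ∈ ℂ}`,
where `φ = (1+√5)/2` is the golden ratio. -/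
theorem stmt17 (φ : ℝ) (hφ : φ = (1 + Real.sqrt 5) / 2)
    (Y : Fin 5 → ℝ × ℝ)
    (hY : ∀ k : Fin 5,
      Y k = (Real.cos (2 * Real.pi * (k : ℕ) / 5),
             Real.sin (2 * Real.pi * (k : ℕ) / 5)))
    (Q5 : AddSubgroup (ℝ × ℝ))
    (hQ5 : Q5 = AddSubgroup.closure (Set.range Y)) :
    {g : Fin 4 → ℂ | ∃ z : Fin 4 → ℂ,
        (∃ q ∈ Q5,
          -(z 0) * ((Y 1).1 : ℂ) - z 1 * ((Y 3).1 : ℂ)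
              + z 2 * ((Y 2).1 : ℂ) + z 3 * ((Y 4).1 : ℂ) = (q.1 : ℂ) ∧
          -(z 0) * ((Y 1).2 : ℂ) - z 1 * ((Y 3).2 : ℂ)
              + z 2 * ((Y 2).2 : ℂ) + z 3 * ((Y 4).2 : ℂ) = (q.2 : ℂ)) ∧
        ∀ j, g j = e2 (z j)} =
      {g : Fin 4 → ℂ | ∃ u v : ℂ,
        g = ![e2 ((φ : ℂ) * u - v), e2 u, e2 v, e2 ((φ : ℂ) * v - u)]} := by
  obtain ⟨S, hS, h0, h1, h2, h3, h4⟩ := fifth_roots_coordinates hφ hY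
  have hsq : (φ : ℂ) ^ 2 = φ + 1 := by exact_mod_cast goldenRatio_sq_eq hφ
  have hS' : (S : ℂ) ≠ 0 := by exact_mod_cast hS
  have hφ1 : (φ : ℂ) - 1 ≠ 0 := by
    intro h
    apply one_ne_zero (α := ℂ)
    linear_combination (φ : ℂ) * h - hsq
  subst hQ5
  ext g
  simp only [Set.mem_ofPred_eq]
  constructor
  · rintro ⟨z, ⟨q, hq, hq1, hq2⟩, hg⟩
    obtain ⟨n, rfl⟩ := AddSubgroup.mem_closure_range_iff_of_fintype.mp hq
    simp only [Fin.sum_univ_five, h0, h1, h2, h3, h4, Prod.smul_mk,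
      Prod.mk_add_mk] at hq1 hq2
    simp only [zsmul_eq_mul] at hq1 hq2
    push_cast at hq1 hq2
    have hsum : (-z 0 + φ * z 1 - z 2) + (z 1 - φ * z 2 + z 3)
        = ((n 1 - n 0) - (n 2 - n 0) - (n 3 - n 0) * φ)
          + ((n 4 - n 0) - (n 3 - n 0) - (n 2 - n 0) * φ) := by
      apply mul_left_cancel₀ hφ1
      linear_combination 2 * hq1 + (z 1 - z 2 + n 2 + n 3 - 2 * n 0) * hsq
    have hdiff : (-z 0 + φ * z 1 - z 2) - (z 1 - φ * z 2 + z 3)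
        = ((n 1 - n 0) - (n 2 - n 0) - (n 3 - n 0) * φ)
          - ((n 4 - n 0) - (n 3 - n 0) - (n 2 - n 0) * φ) := by
      apply mul_left_cancel₀ hS'
      linear_combination hq2
    refine ⟨z 1 + (n 3 - n 0 : ℤ), z 2 + (n 0 - n 2 : ℤ), ?_⟩
    funext j
    rw [hg]
    fin_cases j
    · change e2 (z 0) = e2 _
      rw [← e2_add_intCast (z 0) (n 1 - n 0)]
      congr 1
      push_cast
      linear_combination -(hsum + hdiff) / 2
    · exact (e2_add_intCast _ _).symm
    · exact (e2_add_intCast _ _).symm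
    · change e2 (z 3) = e2 _
      rw [← e2_add_intCast (z 3) (n 0 - n 4)]
      congr 1
      push_cast
      linear_combination (hsum - hdiff) / 2
  · rintro ⟨u, v, rfl⟩
    refine ⟨![φ * u - v, u, v, φ * v - u], ⟨0, zero_mem _, ?_, ?_⟩, ?_⟩
    · simp [h1, h2, h3, h4]
      linear_combination ((v - u) / 2) * hsq
    · simp [h1, h2, h3, h4]
      ring
    · intro j
      fin_cases j <;> rfl
end
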